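/- arXiv:1407.4060 — 2 statements merged into one kernel-verified Lean document; each statement's English description precedes it below -/
import Mathlib

section
/- Let A and B be augmented algebras over a field k with augmentation ideals I = ker ε_A and J = ker ε_B. Then the k-linear map from k ⊕ (⊕_{n>0} ((I⊗J)^{⊗n} ⊕ (J⊗I)^{⊗n})) ⊕ (⊕_{n≥0} ((I⊗J)^{⊗n}⊗I ⊕ (J⊗I)^{⊗n}⊗J)) to A * B, defined on the summand k by λ ↦ λ·1 and on each tensor summand by applying ι_A to the factors from I, applying ι_B to the factors from J, and multiplying in A * B in the given order, is a linear isomorphism. (All tensor products are over k.) -/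
open CategoryTheory

open scoped TensorProduct DirectSum

/-- `P`, together with the canonical maps `ιA : A → P` and `ιB : B → P`, is a coproduct (free
product) of `A` and `B` in the category of unital associative `k`-algebras. -/
def IsFreeProduct (k : Type) [Field k] {A B P : Type} [Ring A] [Algebra k A]
    [Ring B] [Algebra k B] [Ring P] [Algebra k P]
    (ιA : A →ₐ[k] P) (ιB : B →ₐ[k] P) : Prop :=
  ∀ (Q : Type) [Ring Q] [Algebra k Q], ∀ (f : A →ₐ[k] Q) (g : B →ₐ[k] Q),
    ∃! h : P →ₐ[k] Q, h.comp ιA = f ∧ h.comp ιB = g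

/-- The iterated (left-associated) tensor power `M^{⊗n}` over `k`, with `M^{⊗0} = k`. -/
noncomputable def tensPow (k : Type) [Field k] (M : Type) [AddCommGroup M] [Module k M] :
    ℕ → ModuleCat.{0} k
  | 0 => ModuleCat.of k k
  | 1 => ModuleCat.of k M
  | n + 2 => ModuleCat.of k ((tensPow k M (n + 1)) ⊗[k] M)

/-- Given a linear map `μ : M → P` into a `k`-algebra `P`, the linear map `M^{⊗n} → P` sending
`m₁ ⊗ ⋯ ⊗ mₙ` to the product `μ m₁ * ⋯ * μ mₙ` (and `λ ↦ λ·1` when `n = 0`). -/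
noncomputable def tensPowMul (k : Type) [Field k] (M : Type) [AddCommGroup M] [Module k M]
    (P : Type) [Ring P] [Algebra k P] (μ : M →ₗ[k] P) :
    (n : ℕ) → (tensPow k M n : Type) →ₗ[k] P
  | 0 => Algebra.linearMap k P
  | 1 => μ
  | n + 2 => TensorProduct.lift
      (((LinearMap.mul k P).comp (tensPowMul k M P μ (n + 1))).compl₂ μ)

/-- Given linear maps `μ₁ : M₁ → P`, `μ₂ : M₂ → P` into a `k`-algebra `P`, the linear map
`M₁ ⊗ M₂ → P`, `m₁ ⊗ m₂ ↦ μ₁ m₁ * μ₂ m₂`. -/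
noncomputable def mulTwo (k : Type) [Field k] (M₁ M₂ : Type) [AddCommGroup M₁] [Module k M₁]
    [AddCommGroup M₂] [Module k M₂] (P : Type) [Ring P] [Algebra k P]
    (μ₁ : M₁ →ₗ[k] P) (μ₂ : M₂ →ₗ[k] P) : (M₁ ⊗[k] M₂) →ₗ[k] P :=
  TensorProduct.lift (((LinearMap.mul k P).comp μ₁).compl₂ μ₂)

section Statement6

variable (k : Type) [Field k]
  (A B P : Type) [Ring A] [Algebra k A] [Ring B] [Algebra k B] [Ring P] [Algebra k P]
  (ιA : A →ₐ[k] P) (ιB : B →ₐ[k] P) (εA : A →ₐ[k] k) (εB : B →ₐ[k] k)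

/-- The augmentation ideal `I = ker εA`, as a `k`-subspace of `A`. -/
noncomputable def augI : Submodule k A := LinearMap.ker εA.toLinearMap

/-- The augmentation ideal `J = ker εB`, as a `k`-subspace of `B`. -/
noncomputable def augJ : Submodule k B := LinearMap.ker εB.toLinearMap

/-- The multiplication map `I ⊗ J → A * B`, `x ⊗ y ↦ ιA x * ιB y`. -/
noncomputable def muIJ : ((augI k A εA) ⊗[k] (augJ k B εB)) →ₗ[k] P :=
  mulTwo k _ _ P (ιA.toLinearMap ∘ₗ (augI k A εA).subtype)
    (ιB.toLinearMap ∘ₗ (augJ k B εB).subtype)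

/-- The multiplication map `J ⊗ I → A * B`, `y ⊗ x ↦ ιB y * ιA x`. -/
noncomputable def muJI : ((augJ k B εB) ⊗[k] (augI k A εA)) →ₗ[k] P :=
  mulTwo k _ _ P (ιB.toLinearMap ∘ₗ (augJ k B εB).subtype)
    (ιA.toLinearMap ∘ₗ (augI k A εA).subtype)

/-- The map `(I⊗J)^{⊗(n+1)} ⊕ (J⊗I)^{⊗(n+1)} → A * B` given by multiplying out all factors
(in the given order). This realizes the summands indexed by `n > 0` of the middle direct sum. -/
noncomputable def midMap (n : ℕ) :
    ((tensPow k ((augI k A εA) ⊗[k] (augJ k B εB)) (n + 1) : Type) ×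
      (tensPow k ((augJ k B εB) ⊗[k] (augI k A εA)) (n + 1) : Type)) →ₗ[k] P :=
  (tensPowMul k _ P (muIJ k A B P ιA ιB εA εB) (n + 1)).coprod
    (tensPowMul k _ P (muJI k A B P ιA ιB εA εB) (n + 1))

/-- The map `(I⊗J)^{⊗n} ⊗ I ⊕ (J⊗I)^{⊗n} ⊗ J → A * B` given by multiplying out all factors
(in the given order). -/
noncomputable def lastMap (n : ℕ) :
    (((tensPow k ((augI k A εA) ⊗[k] (augJ k B εB)) n : Type) ⊗[k] (augI k A εA)) ×
      ((tensPow k ((augJ k B εB) ⊗[k] (augI k A εA)) n : Type) ⊗[k] (augJ k B εB))) →ₗ[k] P :=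
  (mulTwo k _ _ P (tensPowMul k _ P (muIJ k A B P ιA ιB εA εB) n)
      (ιA.toLinearMap ∘ₗ (augI k A εA).subtype)).coprod
    (mulTwo k _ _ P (tensPowMul k _ P (muJI k A B P ιA ιB εA εB) n)
      (ιB.toLinearMap ∘ₗ (augJ k B εB).subtype))

/-- The total map
`k ⊕ (⊕_{n>0} (I⊗J)^{⊗n} ⊕ (J⊗I)^{⊗n}) ⊕ (⊕_{n≥0} (I⊗J)^{⊗n}⊗I ⊕ (J⊗I)^{⊗n}⊗J) → A * B`,
defined on `k` by `λ ↦ λ·1` and on each tensor summand by applying `ιA` to factors from `I`,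
`ιB` to factors from `J`, and multiplying in `A * B` in the given order. -/
noncomputable def totalMap :
    (k ×
      ((⨁ n : ℕ, ((tensPow k ((augI k A εA) ⊗[k] (augJ k B εB)) (n + 1) : Type) ×
        (tensPow k ((augJ k B εB) ⊗[k] (augI k A εA)) (n + 1) : Type))) ×
       (⨁ n : ℕ, (((tensPow k ((augI k A εA) ⊗[k] (augJ k B εB)) n : Type) ⊗[k] (augI k A εA)) ×
        ((tensPow k ((augJ k B εB) ⊗[k] (augI k A εA)) n : Type) ⊗[k] (augJ k B εB)))))) →ₗ[k] P :=
  (Algebra.linearMap k P).coprod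
    ((DirectSum.toModule k ℕ P (fun n => midMap k A B P ιA ιB εA εB n)).coprod
      (DirectSum.toModule k ℕ P (fun n => lastMap k A B P ιA ιB εA εB n)))

theorem fp_generic {k W A P X Z : Type} [Field k] [Ring A] [Algebra k A] [Ring P] [Algebra k P]
    [AddCommGroup W] [Module k W] [AddCommGroup X] [Module k X] [AddCommGroup Z] [Module k Z]
    (ε : A →ₐ[k] k) (I : Submodule k A) (hI : I = LinearMap.ker ε.toLinearMap)
    (ι : A →ₐ[k] P) (f : W →ₗ[k] P) (e : (X × Z) ≃ₗ[k] W) (z : (X ⊗[k] I) ≃ₗ[k] Z)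
    (hf : ∀ (w : X) (x : I), f (e (0, z (w ⊗ₜ x))) = f (e (w, 0)) * ι x) :
    ∃ ρ : A →ₐ[k] (Module.End k W)ᵐᵒᵖ,
      (∀ (w : X) (x : I), (ρ x).unop (e (w, 0)) = e (0, z (w ⊗ₜ x))) ∧
      (∀ (a : A) (w : W), f ((ρ a).unop w) = f w * ι a) := by
  have hmem : ∀ a : A, a - algebraMap k A (ε a) ∈ I := by
    intro a; rw [hI]; simp
  have hz : ∀ x : I, ε x = 0 := by
    rintro ⟨x, hx⟩; rw [hI] at hx; simpa using hx
  let pr : A →ₗ[k] I := LinearMap.codRestrict I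
    (LinearMap.id - (Algebra.linearMap k A) ∘ₗ ε.toLinearMap) (fun a => by simpa using hmem a)
  have hpr : ∀ a, (pr a : A) = a - algebraMap k A (ε a) := fun a => by simp [pr]
  let dec : A ≃ₗ[k] (k × I) := LinearEquiv.ofLinearMap (ε.toLinearMap.prod pr)
    ((Algebra.linearMap k A).coprod I.subtype)
    (by
      apply LinearMap.ext
      rintro ⟨c, x⟩
      refine Prod.ext ?_ (Subtype.ext ?_)
      · simp [hz]
      · simp [hpr, hz])
    (by
      apply LinearMap.ext
      intro a
      simp [hpr])
  let E : (X ⊗[k] A) ≃ₗ[k] W :=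
    (TensorProduct.congr (LinearEquiv.refl k X) dec).trans
      ((TensorProduct.prodRight k k X k I).trans
        ((LinearEquiv.prodCongr (TensorProduct.rid k X) z).trans e))
  have hE : ∀ w a, E (w ⊗ₜ a) = e (ε a • w, z (w ⊗ₜ pr a)) := by
    intro w a
    simp [E, dec]
  let R : A →ₗ[k] Module.End k W :=
    { toFun := fun a => E.toLinearMap ∘ₗ (LinearMap.lTensor X (LinearMap.mulRight k a)) ∘ₗ
        E.symm.toLinearMap
      map_add' := by
        intro a b
        have : LinearMap.mulRight k (a + b) = LinearMap.mulRight k a + LinearMap.mulRight k b := by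
          ext; simp [mul_add]
        rw [this, LinearMap.lTensor_add, LinearMap.add_comp, LinearMap.comp_add]
      map_smul' := by
        intro c b
        have : LinearMap.mulRight k (c • b) = c • LinearMap.mulRight k b := by
          ext; simp
        rw [this, LinearMap.lTensor_smul, LinearMap.smul_comp, LinearMap.comp_smul]
        rfl }
  have hR : ∀ a t, R a (E t) = E (LinearMap.lTensor X (LinearMap.mulRight k a) t) := by
    intro a t; simp [R]
  let ρ : A →ₐ[k] (Module.End k W)ᵐᵒᵖ := AlgHom.ofLinearMap
    ((MulOpposite.opLinearEquiv k).toLinearMap ∘ₗ R)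
    (by
      apply MulOpposite.unop_injective
      apply LinearMap.ext
      intro w
      obtain ⟨t, rfl⟩ := E.surjective w
      change R 1 (E t) = E t
      rw [hR]
      simp)
    (by
      intro a b
      apply MulOpposite.unop_injective
      apply LinearMap.ext
      intro w
      obtain ⟨t, rfl⟩ := E.surjective w
      change R (a * b) (E t) = R b (R a (E t))
      rw [hR, hR, hR]
      rw [← LinearMap.comp_apply, ← LinearMap.lTensor_comp, LinearMap.mulRight_mul])
  have hρ : ∀ a t, (ρ a).unop (E t) = E (LinearMap.lTensor X (LinearMap.mulRight k a) t) := hR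
  have hfE : ∀ w a, f (E (w ⊗ₜ a)) = f (e (w, 0)) * ι a := by
    intro w a
    have h1 : ((ε a • w, z (w ⊗ₜ pr a)) : X × Z) = ε a • (w, 0) + (0, z (w ⊗ₜ pr a)) := by
      simp
    rw [hE, h1, map_add, map_add, hf, map_smul, map_smul, hpr, map_sub, mul_sub,
      AlgHom.commutes, ← Algebra.commutes, Algebra.smul_def]
    abel
  refine ⟨ρ, ?_, ?_⟩
  · intro w x
    have h1 : e (w, 0) = E (w ⊗ₜ 1) := by
      rw [hE]
      have : pr 1 = 0 := Subtype.ext (by simp [hpr])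
      simp [this]
    have h2 : pr x = x := Subtype.ext (by simp [hpr, hz])
    rw [h1, hρ]
    simp [hE, hz, h2]
  · intro a w
    obtain ⟨t, rfl⟩ := E.surjective w
    rw [hρ]
    induction t using TensorProduct.induction_on with
    | zero => simp
    | add s t hs ht => simp only [map_add, hs, ht, add_mul]
    | tmul w b => simp [hfE, mul_assoc]

theorem fp_top {k A B P : Type} [Field k] [Ring A] [Algebra k A] [Ring B] [Algebra k B]
    [Ring P] [Algebra k P] {ιA : A →ₐ[k] P} {ιB : B →ₐ[k] P} (hfp : IsFreeProduct k ιA ιB)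
    (C : Subalgebra k P) (hA : ∀ a, ιA a ∈ C) (hB : ∀ b, ιB b ∈ C) (p : P) : p ∈ C := by
  obtain ⟨h, ⟨h1, h2⟩, -⟩ := hfp C (ιA.codRestrict C hA) (ιB.codRestrict C hB)
  obtain ⟨g, -, hg⟩ := hfp P ιA ιB
  have e1 := hg (C.val.comp h) ⟨by rw [AlgHom.comp_assoc, h1]; rfl, by rw [AlgHom.comp_assoc, h2]; rfl⟩
  have e2 := hg (AlgHom.id k P) ⟨rfl, rfl⟩
  have e3 : C.val (h p) = p := by
    have := DFunLike.congr_fun (e1.trans e2.symm) p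
    simpa using this
  rw [← e3]
  exact (h p).2

theorem fp_core {k A B P W : Type} [Field k] [Ring A] [Algebra k A] [Ring B] [Algebra k B]
    [Ring P] [Algebra k P] {ιA : A →ₐ[k] P} {ιB : B →ₐ[k] P} (hfp : IsFreeProduct k ιA ιB)
    [AddCommGroup W] [Module k W] (one : W) (f : W →ₗ[k] P)
    (ρA : A →ₐ[k] (Module.End k W)ᵐᵒᵖ) (ρB : B →ₐ[k] (Module.End k W)ᵐᵒᵖ) (h1 : f one = 1)
    (hA : ∀ a w, f ((ρA a).unop w) = f w * ιA a) (hB : ∀ a w, f ((ρB a).unop w) = f w * ιB a)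
    (hgen : ∀ N : Submodule k W, one ∈ N → (∀ a, ∀ w ∈ N, (ρA a).unop w ∈ N) →
      (∀ a, ∀ w ∈ N, (ρB a).unop w ∈ N) → ∀ w, w ∈ N) :
    Function.Bijective f := by
  obtain ⟨h, ⟨hhA, hhB⟩, -⟩ := hfp _ ρA ρB
  have hhA' : ∀ a, h (ιA a) = ρA a := fun a => DFunLike.congr_fun hhA a
  have hhB' : ∀ a, h (ιB a) = ρB a := fun a => DFunLike.congr_fun hhB a
  let C : Subalgebra k P :=
    { carrier := {p | ∀ w, f ((h p).unop w) = f w * p}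
      mul_mem' := by
        intro p q hp hq w
        simp only [Set.mem_ofPred_eq] at hp hq
        rw [map_mul, MulOpposite.unop_mul, Module.End.mul_apply, hq, hp, mul_assoc]
      add_mem' := by
        intro p q hp hq w
        simp only [Set.mem_ofPred_eq] at hp hq
        rw [map_add, MulOpposite.unop_add, LinearMap.add_apply, map_add, hq, hp, mul_add]
      algebraMap_mem' := by
        intro c w
        rw [AlgHom.commutes, MulOpposite.algebraMap_apply, MulOpposite.unop_op,
          Module.algebraMap_end_apply, map_smul, ← Algebra.commutes, Algebra.smul_def] }
  have hC : ∀ p w, f ((h p).unop w) = f w * p := fun p =>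
    fp_top hfp C (fun a w => by rw [hhA', hA]) (fun a w => by rw [hhB', hB]) p
  constructor
  · let Ψ : P →ₗ[k] W := (LinearMap.applyₗ one) ∘ₗ
      (MulOpposite.opLinearEquiv k).symm.toLinearMap ∘ₗ h.toLinearMap
    have hΨ : ∀ p, Ψ p = (h p).unop one := fun p => rfl
    have key : ∀ w, w ∈ LinearMap.eqLocus (Ψ ∘ₗ f) LinearMap.id := by
      apply hgen
      · simp [hΨ, h1]
      · intro a w hw
        simp only [LinearMap.mem_eqLocus, LinearMap.comp_apply, LinearMap.id_apply, hΨ] at hw ⊢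
        rw [hA, map_mul, MulOpposite.unop_mul, Module.End.mul_apply, hw, hhA']
      · intro a w hw
        simp only [LinearMap.mem_eqLocus, LinearMap.comp_apply, LinearMap.id_apply, hΨ] at hw ⊢
        rw [hB, map_mul, MulOpposite.unop_mul, Module.End.mul_apply, hw, hhB']
    have : Function.LeftInverse Ψ f := fun w => key w
    exact this.injective
  · intro p
    exact ⟨_, (hC p one).trans (by rw [h1, one_mul])⟩

/-- `M^{⊗n} ⊗ M ≃ M^{⊗(n+1)}`. -/
noncomputable def tsucc (k M : Type) [Field k] [AddCommGroup M] [Module k M] :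
    (n : ℕ) → ((tensPow k M n : Type) ⊗[k] M) ≃ₗ[k] (tensPow k M (n + 1) : Type)
  | 0 => TensorProduct.lid k M
  | n + 1 => LinearEquiv.refl k ((tensPow k M (n + 1) : Type) ⊗[k] M)

theorem tsucc_mul (k M P : Type) [Field k] [AddCommGroup M] [Module k M] [Ring P] [Algebra k P]
    (μ : M →ₗ[k] P) (n : ℕ) (t : (tensPow k M n : Type)) (m : M) :
    tensPowMul k M P μ (n + 1) (tsucc k M n (t ⊗ₜ m)) = tensPowMul k M P μ n t * μ m := by
  cases n with
  | zero =>
    have key : ∀ c : k, μ (TensorProduct.lid k M (c ⊗ₜ m)) = algebraMap k P c * μ m := by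
      intro c
      rw [TensorProduct.lid_tmul, map_smul, Algebra.smul_def]
    exact key t
  | succ n => rfl

section Split

variable {k : Type} [Field k] (T S U V : ℕ → Type)
  [∀ n, AddCommGroup (T n)] [∀ n, Module k (T n)] [∀ n, AddCommGroup (S n)] [∀ n, Module k (S n)]
  [∀ n, AddCommGroup (U n)] [∀ n, Module k (U n)] [∀ n, AddCommGroup (V n)] [∀ n, Module k (V n)]
  (T0 : k ≃ₗ[k] T 0) (S0 : k ≃ₗ[k] S 0)

/-- The space of alternating words. -/
abbrev WordSp (k : Type) (T S U V : ℕ → Type) [Field k]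
    [∀ n, AddCommGroup (T n)] [∀ n, AddCommGroup (S n)]
    [∀ n, AddCommGroup (U n)] [∀ n, AddCommGroup (V n)] : Type :=
  k × ((⨁ n : ℕ, (T (n + 1) × S (n + 1))) × (⨁ n : ℕ, (U n × V n)))

/-- Inclusion of `T n`. -/
noncomputable def embT : (n : ℕ) → T n →ₗ[k] WordSp k T S U V
  | 0 => LinearMap.inl k _ _ ∘ₗ T0.symm.toLinearMap
  | n + 1 => LinearMap.inr k _ _ ∘ₗ LinearMap.inl k _ _ ∘ₗ
      DirectSum.lof k ℕ (fun n => T (n + 1) × S (n + 1)) n ∘ₗ LinearMap.inl k _ _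

/-- Inclusion of `S n`. -/
noncomputable def embS : (n : ℕ) → S n →ₗ[k] WordSp k T S U V
  | 0 => LinearMap.inl k _ _ ∘ₗ S0.symm.toLinearMap
  | n + 1 => LinearMap.inr k _ _ ∘ₗ LinearMap.inl k _ _ ∘ₗ
      DirectSum.lof k ℕ (fun n => T (n + 1) × S (n + 1)) n ∘ₗ LinearMap.inr k _ _

/-- Inclusion of `U n`. -/
noncomputable def embU (n : ℕ) : U n →ₗ[k] WordSp k T S U V :=
  LinearMap.inr k _ _ ∘ₗ LinearMap.inr k _ _ ∘ₗ
      DirectSum.lof k ℕ (fun n => U n × V n) n ∘ₗ LinearMap.inl k _ _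

/-- Inclusion of `V n`. -/
noncomputable def embV (n : ℕ) : V n →ₗ[k] WordSp k T S U V :=
  LinearMap.inr k _ _ ∘ₗ LinearMap.inr k _ _ ∘ₗ
      DirectSum.lof k ℕ (fun n => U n × V n) n ∘ₗ LinearMap.inr k _ _

/-- Splitting of the space of words with respect to the first algebra. -/
noncomputable def splitA :
    (((⨁ n, T n) × (⨁ n, V n)) × ((⨁ n, U n) × (⨁ n, S (n + 1)))) ≃ₗ[k] WordSp k T S U V :=
  LinearEquiv.ofLinearMap
    (((DirectSum.toModule k ℕ _ (embT T S U V T0)).coprod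
      (DirectSum.toModule k ℕ _ (embV T S U V))).coprod
     ((DirectSum.toModule k ℕ _ (embU T S U V)).coprod
      (DirectSum.toModule k ℕ _ (fun n => embS T S U V S0 (n + 1)))))
    ((LinearMap.inl k _ _ ∘ₗ LinearMap.inl k _ _ ∘ₗ DirectSum.lof k ℕ T 0 ∘ₗ T0.toLinearMap).coprod
      ((DirectSum.toModule k ℕ _ (fun n =>
        (LinearMap.inl k _ _ ∘ₗ LinearMap.inl k _ _ ∘ₗ DirectSum.lof k ℕ T (n + 1)).coprod
        (LinearMap.inr k _ _ ∘ₗ LinearMap.inr k _ _ ∘ₗ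
          DirectSum.lof k ℕ (fun n => S (n + 1)) n))).coprod
       (DirectSum.toModule k ℕ _ (fun n =>
        (LinearMap.inr k _ _ ∘ₗ LinearMap.inl k _ _ ∘ₗ DirectSum.lof k ℕ U n).coprod
        (LinearMap.inl k _ _ ∘ₗ LinearMap.inr k _ _ ∘ₗ DirectSum.lof k ℕ V n)))))
    (by
      refine LinearMap.prod_ext ?_ (LinearMap.prod_ext ?_ ?_)
      · apply LinearMap.ext
        intro c
        simp [embT]
      · refine DirectSum.linearMap_ext _ fun n => LinearMap.prod_ext ?_ ?_
        · apply LinearMap.ext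
          intro c
          simp [embT]
        · apply LinearMap.ext
          intro c
          simp [embS]
      · refine DirectSum.linearMap_ext _ fun n => LinearMap.prod_ext ?_ ?_
        · apply LinearMap.ext
          intro c
          simp [embU]
        · apply LinearMap.ext
          intro c
          simp [embV])
    (by
      refine LinearMap.prod_ext (LinearMap.prod_ext ?_ ?_) (LinearMap.prod_ext ?_ ?_)
      · refine DirectSum.linearMap_ext _ fun n => LinearMap.ext fun c => ?_
        cases n <;> simp [embT]
      · refine DirectSum.linearMap_ext _ fun n => LinearMap.ext fun c => ?_
        simp [embV]
      · refine DirectSum.linearMap_ext _ fun n => LinearMap.ext fun c => ?_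
        simp [embU]
      · refine DirectSum.linearMap_ext _ fun n => LinearMap.ext fun c => ?_
        simp [embS])

/-- Splitting of the space of words with respect to the second algebra. -/
noncomputable def splitB :
    (((⨁ n, S n) × (⨁ n, U n)) × ((⨁ n, V n) × (⨁ n, T (n + 1)))) ≃ₗ[k] WordSp k T S U V :=
  LinearEquiv.ofLinearMap
    (((DirectSum.toModule k ℕ _ (embS T S U V S0)).coprod
      (DirectSum.toModule k ℕ _ (embU T S U V))).coprod
     ((DirectSum.toModule k ℕ _ (embV T S U V)).coprod
      (DirectSum.toModule k ℕ _ (fun n => embT T S U V T0 (n + 1)))))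
    ((LinearMap.inl k _ _ ∘ₗ LinearMap.inl k _ _ ∘ₗ DirectSum.lof k ℕ S 0 ∘ₗ S0.toLinearMap).coprod
      ((DirectSum.toModule k ℕ _ (fun n =>
        (LinearMap.inr k _ _ ∘ₗ LinearMap.inr k _ _ ∘ₗ
          DirectSum.lof k ℕ (fun n => T (n + 1)) n).coprod
        (LinearMap.inl k _ _ ∘ₗ LinearMap.inl k _ _ ∘ₗ DirectSum.lof k ℕ S (n + 1)))).coprod
       (DirectSum.toModule k ℕ _ (fun n =>
        (LinearMap.inl k _ _ ∘ₗ LinearMap.inr k _ _ ∘ₗ DirectSum.lof k ℕ U n).coprod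
        (LinearMap.inr k _ _ ∘ₗ LinearMap.inl k _ _ ∘ₗ DirectSum.lof k ℕ V n)))))
    (by
      refine LinearMap.prod_ext ?_ (LinearMap.prod_ext ?_ ?_)
      · apply LinearMap.ext
        intro c
        simp [embS]
      · refine DirectSum.linearMap_ext _ fun n => LinearMap.prod_ext ?_ ?_
        · apply LinearMap.ext
          intro c
          simp [embT]
        · apply LinearMap.ext
          intro c
          simp [embS]
      · refine DirectSum.linearMap_ext _ fun n => LinearMap.prod_ext ?_ ?_
        · apply LinearMap.ext
          intro c
          simp [embU]
        · apply LinearMap.ext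
          intro c
          simp [embV])
    (by
      refine LinearMap.prod_ext (LinearMap.prod_ext ?_ ?_) (LinearMap.prod_ext ?_ ?_)
      · refine DirectSum.linearMap_ext _ fun n => LinearMap.ext fun c => ?_
        cases n <;> simp [embS]
      · refine DirectSum.linearMap_ext _ fun n => LinearMap.ext fun c => ?_
        simp [embU]
      · refine DirectSum.linearMap_ext _ fun n => LinearMap.ext fun c => ?_
        simp [embV]
      · refine DirectSum.linearMap_ext _ fun n => LinearMap.ext fun c => ?_
        simp [embT])

/-- The auxiliary identification of `X ⊗ I` with the other half of the words. -/
noncomputable def zIso (I : Type) [AddCommGroup I] [Module k I]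
    (eU : ∀ n, (T n ⊗[k] I) ≃ₗ[k] U n) (eS : ∀ n, (V n ⊗[k] I) ≃ₗ[k] S (n + 1)) :
    (((⨁ n, T n) × (⨁ n, V n)) ⊗[k] I) ≃ₗ[k] ((⨁ n, U n) × (⨁ n, S (n + 1))) :=
  (TensorProduct.prodLeft k k _ _ _).trans
    (LinearEquiv.prodCongr
      ((TensorProduct.directSumLeft k k T I).trans (DFinsupp.mapRange.linearEquiv eU))
      ((TensorProduct.directSumLeft k k V I).trans (DFinsupp.mapRange.linearEquiv eS)))

theorem zIso_left (I : Type) [AddCommGroup I] [Module k I]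
    (eU : ∀ n, (T n ⊗[k] I) ≃ₗ[k] U n) (eS : ∀ n, (V n ⊗[k] I) ≃ₗ[k] S (n + 1))
    (n : ℕ) (t : T n) (x : I) :
    zIso T S U V I eU eS ((DirectSum.lof k ℕ T n t, 0) ⊗ₜ x) =
      (DirectSum.lof k ℕ U n (eU n (t ⊗ₜ x)), 0) := by
  have h : DFinsupp.mapRange.linearEquiv eU (DirectSum.lof k ℕ (fun n => T n ⊗[k] I) n (t ⊗ₜ x)) =
      DirectSum.lof k ℕ U n (eU n (t ⊗ₜ x)) :=
    DFinsupp.mapRange_single (hf := fun i => map_zero (eU i))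
  simp only [zIso, LinearEquiv.trans_apply, TensorProduct.prodLeft_tmul,
    LinearEquiv.prodCongr_apply, TensorProduct.directSumLeft_tmul_lof, TensorProduct.zero_tmul,
    map_zero, h]

theorem zIso_right (I : Type) [AddCommGroup I] [Module k I]
    (eU : ∀ n, (T n ⊗[k] I) ≃ₗ[k] U n) (eS : ∀ n, (V n ⊗[k] I) ≃ₗ[k] S (n + 1))
    (n : ℕ) (t : V n) (x : I) :
    zIso T S U V I eU eS ((0, DirectSum.lof k ℕ V n t) ⊗ₜ x) =
      (0, DirectSum.lof k ℕ (fun n => S (n + 1)) n (eS n (t ⊗ₜ x))) := by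
  have h : DFinsupp.mapRange.linearEquiv eS (DirectSum.lof k ℕ (fun n => V n ⊗[k] I) n (t ⊗ₜ x)) =
      DirectSum.lof k ℕ (fun n => S (n + 1)) n (eS n (t ⊗ₜ x)) :=
    DFinsupp.mapRange_single (hf := fun i => map_zero (eS i))
  simp only [zIso, LinearEquiv.trans_apply, TensorProduct.prodLeft_tmul,
    LinearEquiv.prodCongr_apply, TensorProduct.directSumLeft_tmul_lof, TensorProduct.zero_tmul,
    map_zero, h]

theorem tot_T {P : Type} [AddCommGroup P] [Module k P] (g : k →ₗ[k] P)
    (m : ∀ n, (T (n + 1) × S (n + 1)) →ₗ[k] P) (l : ∀ n, (U n × V n) →ₗ[k] P)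
    (n : ℕ) (t : T (n + 1)) :
    (g.coprod ((DirectSum.toModule k ℕ P m).coprod (DirectSum.toModule k ℕ P l)))
      (embT T S U V T0 (n + 1) t) = m n (t, 0) := by
  simp [embT]

theorem tot_S {P : Type} [AddCommGroup P] [Module k P] (g : k →ₗ[k] P)
    (m : ∀ n, (T (n + 1) × S (n + 1)) →ₗ[k] P) (l : ∀ n, (U n × V n) →ₗ[k] P)
    (n : ℕ) (t : S (n + 1)) :
    (g.coprod ((DirectSum.toModule k ℕ P m).coprod (DirectSum.toModule k ℕ P l)))
      (embS T S U V S0 (n + 1) t) = m n (0, t) := by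
  simp [embS]

theorem tot_U {P : Type} [AddCommGroup P] [Module k P] (g : k →ₗ[k] P)
    (m : ∀ n, (T (n + 1) × S (n + 1)) →ₗ[k] P) (l : ∀ n, (U n × V n) →ₗ[k] P)
    (n : ℕ) (t : U n) :
    (g.coprod ((DirectSum.toModule k ℕ P m).coprod (DirectSum.toModule k ℕ P l)))
      (embU T S U V n t) = l n (t, 0) := by
  simp [embU]

theorem tot_V {P : Type} [AddCommGroup P] [Module k P] (g : k →ₗ[k] P)
    (m : ∀ n, (T (n + 1) × S (n + 1)) →ₗ[k] P) (l : ∀ n, (U n × V n) →ₗ[k] P)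
    (n : ℕ) (t : V n) :
    (g.coprod ((DirectSum.toModule k ℕ P m).coprod (DirectSum.toModule k ℕ P l)))
      (embV T S U V n t) = l n (0, t) := by
  simp [embV]

end Split

/-- Generic bilinear check on `X = ⨁ T × ⨁ V`. -/
theorem fp_bil {k I P : Type} [Field k] [AddCommGroup I] [Module k I] [AddCommGroup P] [Module k P]
    (T V : ℕ → Type)
    [∀ n, AddCommGroup (T n)] [∀ n, Module k (T n)] [∀ n, AddCommGroup (V n)] [∀ n, Module k (V n)]
    (f g : ((⨁ n, T n) × (⨁ n, V n)) →ₗ[k] I →ₗ[k] P)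
    (h1 : ∀ n t x, f (DirectSum.lof k ℕ T n t, 0) x = g (DirectSum.lof k ℕ T n t, 0) x)
    (h2 : ∀ n t x, f (0, DirectSum.lof k ℕ V n t) x = g (0, DirectSum.lof k ℕ V n t) x) :
    f = g := by
  refine LinearMap.prod_ext ?_ ?_
  · exact DirectSum.linearMap_ext _ fun n => LinearMap.ext fun t => LinearMap.ext fun x => h1 n t x
  · exact DirectSum.linearMap_ext _ fun n => LinearMap.ext fun t => LinearMap.ext fun x => h2 n t x

/-- Abstract version of the theorem. -/
theorem fp_abstract {k A B P : Type} [Field k] [Ring A] [Algebra k A] [Ring B] [Algebra k B]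
    [Ring P] [Algebra k P] {ιA : A →ₐ[k] P} {ιB : B →ₐ[k] P} (hfp : IsFreeProduct k ιA ιB)
    (εA : A →ₐ[k] k) (εB : B →ₐ[k] k)
    (I : Submodule k A) (hI : I = LinearMap.ker εA.toLinearMap)
    (J : Submodule k B) (hJ : J = LinearMap.ker εB.toLinearMap)
    (T S U V : ℕ → Type)
    [∀ n, AddCommGroup (T n)] [∀ n, Module k (T n)] [∀ n, AddCommGroup (S n)] [∀ n, Module k (S n)]
    [∀ n, AddCommGroup (U n)] [∀ n, Module k (U n)] [∀ n, AddCommGroup (V n)] [∀ n, Module k (V n)]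
    (T0 : k ≃ₗ[k] T 0) (S0 : k ≃ₗ[k] S 0)
    (eU : ∀ n, (T n ⊗[k] I) ≃ₗ[k] U n) (eS : ∀ n, (V n ⊗[k] I) ≃ₗ[k] S (n + 1))
    (eV : ∀ n, (S n ⊗[k] J) ≃ₗ[k] V n) (eT : ∀ n, (U n ⊗[k] J) ≃ₗ[k] T (n + 1))
    (f : WordSp k T S U V →ₗ[k] P) (h1 : f (1, 0) = 1)
    (hU : ∀ n t x, f (embU T S U V n (eU n (t ⊗ₜ x))) = f (embT T S U V T0 n t) * ιA x)
    (hS : ∀ n t x, f (embS T S U V S0 (n + 1) (eS n (t ⊗ₜ x))) = f (embV T S U V n t) * ιA x)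
    (hV : ∀ n t x, f (embV T S U V n (eV n (t ⊗ₜ x))) = f (embS T S U V S0 n t) * ιB x)
    (hT : ∀ n t x, f (embT T S U V T0 (n + 1) (eT n (t ⊗ₜ x))) = f (embU T S U V n t) * ιB x) :
    Function.Bijective f := by
  have a1 : ∀ n t, splitA T S U V T0 S0 ((DirectSum.lof k ℕ T n t, 0), 0) = embT T S U V T0 n t := by
    intro n t; simp [splitA]
  have a2 : ∀ n t, splitA T S U V T0 S0 ((0, DirectSum.lof k ℕ V n t), 0) = embV T S U V n t := by
    intro n t; simp [splitA]
  have a3 : ∀ n t, splitA T S U V T0 S0 (0, (DirectSum.lof k ℕ U n t, 0)) = embU T S U V n t := by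
    intro n t; simp [splitA]
  have a4 : ∀ n t, splitA T S U V T0 S0 (0, (0, DirectSum.lof k ℕ (fun n => S (n + 1)) n t)) =
      embS T S U V S0 (n + 1) t := by
    intro n t; simp [splitA]
  have b1 : ∀ n t, splitB T S U V T0 S0 ((DirectSum.lof k ℕ S n t, 0), 0) = embS T S U V S0 n t := by
    intro n t; simp [splitB]
  have b2 : ∀ n t, splitB T S U V T0 S0 ((0, DirectSum.lof k ℕ U n t), 0) = embU T S U V n t := by
    intro n t; simp [splitB]
  have b3 : ∀ n t, splitB T S U V T0 S0 (0, (DirectSum.lof k ℕ V n t, 0)) = embV T S U V n t := by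
    intro n t; simp [splitB]
  have b4 : ∀ n t, splitB T S U V T0 S0 (0, (0, DirectSum.lof k ℕ (fun n => T (n + 1)) n t)) =
      embT T S U V T0 (n + 1) t := by
    intro n t; simp [splitB]
  obtain ⟨ρA, rA, fA⟩ := fp_generic εA I hI ιA f (splitA T S U V T0 S0) (zIso T S U V I eU eS) (by
    intro w x
    have := fp_bil (P := P) T V
      (LinearMap.compr₂ (TensorProduct.mk k _ I) (f ∘ₗ (splitA T S U V T0 S0).toLinearMap ∘ₗ
        LinearMap.inr k _ _ ∘ₗ (zIso T S U V I eU eS).toLinearMap))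
      (((LinearMap.mul k P).comp (f ∘ₗ (splitA T S U V T0 S0).toLinearMap ∘ₗ
        LinearMap.inl k _ _)).compl₂ (ιA.toLinearMap ∘ₗ I.subtype))
      (by
        intro n t x
        change f (splitA T S U V T0 S0 (0, zIso T S U V I eU eS _)) =
          f (splitA T S U V T0 S0 (_, 0)) * ιA x
        rw [TensorProduct.mk_apply, LinearMap.id_apply, zIso_left, a1, a3, hU])
      (by
        intro n t x
        change f (splitA T S U V T0 S0 (0, zIso T S U V I eU eS _)) =
          f (splitA T S U V T0 S0 (_, 0)) * ιA x
        rw [TensorProduct.mk_apply, LinearMap.id_apply, zIso_right, a2, a4, hS])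
    exact DFunLike.congr_fun (DFunLike.congr_fun this w) x)
  obtain ⟨ρB, rB, fB⟩ := fp_generic εB J hJ ιB f (splitB T S U V T0 S0) (zIso S T V U J eV eT) (by
    intro w x
    have := fp_bil (P := P) S U
      (LinearMap.compr₂ (TensorProduct.mk k _ J) (f ∘ₗ (splitB T S U V T0 S0).toLinearMap ∘ₗ
        LinearMap.inr k _ _ ∘ₗ (zIso S T V U J eV eT).toLinearMap))
      (((LinearMap.mul k P).comp (f ∘ₗ (splitB T S U V T0 S0).toLinearMap ∘ₗ
        LinearMap.inl k _ _)).compl₂ (ιB.toLinearMap ∘ₗ J.subtype))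
      (by
        intro n t x
        change f (splitB T S U V T0 S0 (0, zIso S T V U J eV eT _)) =
          f (splitB T S U V T0 S0 (_, 0)) * ιB x
        rw [TensorProduct.mk_apply, LinearMap.id_apply, zIso_left, b1, b3, hV])
      (by
        intro n t x
        change f (splitB T S U V T0 S0 (0, zIso S T V U J eV eT _)) =
          f (splitB T S U V T0 S0 (_, 0)) * ιB x
        rw [TensorProduct.mk_apply, LinearMap.id_apply, zIso_right, b2, b4, hT])
    exact DFunLike.congr_fun (DFunLike.congr_fun this w) x)
  refine fp_core hfp (1, 0) f ρA ρB h1 fA fB ?_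
  intro N hone hNA hNB
  have sU : ∀ n, (∀ t, embT T S U V T0 n t ∈ N) → ∀ u, embU T S U V n u ∈ N := by
    intro n hn u
    obtain ⟨u, rfl⟩ := (eU n).surjective u
    induction u using TensorProduct.induction_on with
    | zero => simp
    | add s t hs ht => simpa only [map_add] using N.add_mem hs ht
    | tmul t x =>
      have := rA (DirectSum.lof k ℕ T n t, 0) x
      rw [zIso_left, a1, a3] at this
      rw [← this]
      exact hNA _ _ (hn t)
  have sS : ∀ n, (∀ t, embV T S U V n t ∈ N) → ∀ u, embS T S U V S0 (n + 1) u ∈ N := by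
    intro n hn u
    obtain ⟨u, rfl⟩ := (eS n).surjective u
    induction u using TensorProduct.induction_on with
    | zero => simp
    | add s t hs ht => simpa only [map_add] using N.add_mem hs ht
    | tmul t x =>
      have := rA (0, DirectSum.lof k ℕ V n t) x
      rw [zIso_right, a2, a4] at this
      rw [← this]
      exact hNA _ _ (hn t)
  have sV : ∀ n, (∀ t, embS T S U V S0 n t ∈ N) → ∀ u, embV T S U V n u ∈ N := by
    intro n hn u
    obtain ⟨u, rfl⟩ := (eV n).surjective u
    induction u using TensorProduct.induction_on with
    | zero => simp
    | add s t hs ht => simpa only [map_add] using N.add_mem hs ht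
    | tmul t x =>
      have := rB (DirectSum.lof k ℕ S n t, 0) x
      rw [zIso_left, b1, b3] at this
      rw [← this]
      exact hNB _ _ (hn t)
  have sT : ∀ n, (∀ t, embU T S U V n t ∈ N) → ∀ u, embT T S U V T0 (n + 1) u ∈ N := by
    intro n hn u
    obtain ⟨u, rfl⟩ := (eT n).surjective u
    induction u using TensorProduct.induction_on with
    | zero => simp
    | add s t hs ht => simpa only [map_add] using N.add_mem hs ht
    | tmul t x =>
      have := rB (0, DirectSum.lof k ℕ U n t) x
      rw [zIso_right, b2, b4] at this
      rw [← this]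
      exact hNB _ _ (hn t)
  have hk : ∀ c : k, ((c, 0) : WordSp k T S U V) ∈ N := by
    intro c
    have := N.smul_mem c hone
    simpa using this
  have tT : ∀ n t, embT T S U V T0 n t ∈ N := by
    intro n
    induction n with
    | zero => intro t; exact hk _
    | succ n ih => exact sT n (sU n ih)
  have tS : ∀ n t, embS T S U V S0 n t ∈ N := by
    intro n
    induction n with
    | zero => intro t; exact hk _
    | succ n ih => exact sS n (sV n ih)
  have tU := fun n => sU n (tT n)
  have tV := fun n => sV n (tS n)
  have hq : N.mkQ ∘ₗ (splitA T S U V T0 S0).toLinearMap = 0 := by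
    refine LinearMap.prod_ext (LinearMap.prod_ext ?_ ?_) (LinearMap.prod_ext ?_ ?_)
    · refine DirectSum.linearMap_ext _ fun n => LinearMap.ext fun c => ?_
      change N.mkQ (splitA T S U V T0 S0 ((DirectSum.lof k ℕ T n c, 0), 0)) = 0
      rw [a1]; simpa using tT n c
    · refine DirectSum.linearMap_ext _ fun n => LinearMap.ext fun c => ?_
      change N.mkQ (splitA T S U V T0 S0 ((0, DirectSum.lof k ℕ V n c), 0)) = 0
      rw [a2]; simpa using tV n c
    · refine DirectSum.linearMap_ext _ fun n => LinearMap.ext fun c => ?_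
      change N.mkQ (splitA T S U V T0 S0 (0, (DirectSum.lof k ℕ U n c, 0))) = 0
      rw [a3]; simpa using tU n c
    · refine DirectSum.linearMap_ext _ fun n => LinearMap.ext fun c => ?_
      change N.mkQ (splitA T S U V T0 S0
        (0, (0, DirectSum.lof k ℕ (fun n => S (n + 1)) n c))) = 0
      rw [a4]; simpa using tS (n + 1) c
  intro w
  obtain ⟨v, rfl⟩ := (splitA T S U V T0 S0).surjective w
  have := DFunLike.congr_fun hq v
  simpa using this

/-- Let `A` and `B` be augmented algebras over a field `k` with augmentation
ideals `I = ker εA` and `J = ker εB`. Then the `k`-linear map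
`k ⊕ (⊕_{n>0} ((I⊗J)^{⊗n} ⊕ (J⊗I)^{⊗n})) ⊕ (⊕_{n≥0} ((I⊗J)^{⊗n}⊗I ⊕ (J⊗I)^{⊗n}⊗J)) → A * B`,
defined on `k` by `λ ↦ λ·1` and on each tensor summand by applying `ιA` to the factors from
`I`, applying `ιB` to the factors from `J`, and multiplying in `A * B` in the given order, is a
linear isomorphism. -/
theorem statement6
    (hfp : IsFreeProduct k ιA ιB) :
    Function.Bijective (totalMap k A B P ιA ιB εA εB) := by
  let T : ℕ → Type := fun n => (tensPow k ((augI k A εA) ⊗[k] (augJ k B εB)) n : Type)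
  let S : ℕ → Type := fun n => (tensPow k ((augJ k B εB) ⊗[k] (augI k A εA)) n : Type)
  let U : ℕ → Type := fun n => T n ⊗[k] (augI k A εA)
  let V : ℕ → Type := fun n => S n ⊗[k] (augJ k B εB)
  have fT : ∀ n t, totalMap k A B P ιA ιB εA εB
      (embT T S U V (LinearEquiv.refl k k : k ≃ₗ[k] T 0) n t) =
      tensPowMul k _ P (muIJ k A B P ιA ιB εA εB) n t := by
    intro n t
    cases n with
    | zero => simp [totalMap, embT]; rfl
    | succ n => exact (tot_T T S U V _ _ _ _ n t).trans (by simp [midMap])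
  have fS : ∀ n t, totalMap k A B P ιA ιB εA εB
      (embS T S U V (LinearEquiv.refl k k : k ≃ₗ[k] S 0) n t) =
      tensPowMul k _ P (muJI k A B P ιA ιB εA εB) n t := by
    intro n t
    cases n with
    | zero => simp [totalMap, embS]; rfl
    | succ n => exact (tot_S T S U V _ _ _ _ n t).trans (by simp [midMap])
  have fU : ∀ n t, totalMap k A B P ιA ιB εA εB (embU T S U V n t) =
      mulTwo k _ _ P (tensPowMul k _ P (muIJ k A B P ιA ιB εA εB) n)
      (ιA.toLinearMap ∘ₗ (augI k A εA).subtype) t := by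
    intro n t
    exact (tot_U T S U V _ _ _ n t).trans (by simp [lastMap])
  have fV : ∀ n t, totalMap k A B P ιA ιB εA εB (embV T S U V n t) =
      mulTwo k _ _ P (tensPowMul k _ P (muJI k A B P ιA ιB εA εB) n)
      (ιB.toLinearMap ∘ₗ (augJ k B εB).subtype) t := by
    intro n t
    exact (tot_V T S U V _ _ _ n t).trans (by simp [lastMap])
  refine fp_abstract hfp εA εB (augI k A εA) rfl (augJ k B εB) rfl T S U V
    (LinearEquiv.refl k k) (LinearEquiv.refl k k)
    (fun n => LinearEquiv.refl k _)
    (fun n => (TensorProduct.assoc k _ _ _).trans (tsucc k _ n))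
    (fun n => LinearEquiv.refl k _)
    (fun n => (TensorProduct.assoc k _ _ _).trans (tsucc k _ n))
    (totalMap k A B P ιA ιB εA εB) ?_ ?_ ?_ ?_ ?_
  · simp [totalMap]
  · intro n t x
    rw [fU, fT]
    rfl
  · intro n t x
    rw [fS, fV]
    induction t using TensorProduct.induction_on with
    | zero => simp
    | add s t hs ht => simp only [TensorProduct.add_tmul, map_add, hs, ht, add_mul]
    | tmul t y =>
      rw [LinearEquiv.trans_apply, TensorProduct.assoc_tmul, tsucc_mul]
      simp [muJI, mulTwo, mul_assoc]
  · intro n t x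
    rw [fV, fS]
    rfl
  · intro n t x
    rw [fT, fU]
    induction t using TensorProduct.induction_on with
    | zero => simp
    | add s t hs ht => simp only [TensorProduct.add_tmul, map_add, hs, ht, add_mul]
    | tmul t y =>
      rw [LinearEquiv.trans_apply, TensorProduct.assoc_tmul, tsucc_mul]
      simp [muIJ, mulTwo, mul_assoc]

end Statement6
end

section
/- Let A and B be augmented algebras over a field k. Then the free product A * B, regarded as a left A-module via the canonical homomorphism ι_A : A → A * B, is a free A-module. -/
open CategoryTheory

namespace FreeProd

/-- A basis of a nontrivial algebra containing `1`, indexed by an `Option` type. -/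
lemma exists_basis (k : Type) [Field k] (A : Type) [Ring A] [Algebra k A] [Nontrivial A] :
    ∃ (I : Type) (b : Module.Basis (Option I) k A), b none = 1 := by
  classical
  have hli : LinearIndepOn k id ({1} : Set A) :=
    LinearIndepOn.singleton (R := k) (v := (id : A → A)) (i := 1) one_ne_zero
  let b := Module.Basis.extend hli
  have h1 : (1 : A) ∈ hli.extend (Set.subset_univ _) :=
    hli.subset_extend _ (Set.mem_singleton _)
  let x : hli.extend (Set.subset_univ _) := ⟨1, h1⟩
  refine ⟨_, b.reindex (Equiv.optionSubtypeNe x).symm, ?_⟩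
  simp [b, x]

section Action

variable {k : Type} [Field k] {A : Type} [Ring A] [Algebra k A]
  {I U X : Type} (b : Module.Basis (Option I) k A) (e : X ≃ Option I × U)

/-- The identification of the space with basis `X` with the free `A`-module on `U`. -/
noncomputable def T : (X →₀ k) ≃ₗ[k] (U →₀ A) :=
  (Finsupp.domLCongr (e.trans (Equiv.prodComm _ _))).trans
    ((Finsupp.curryLinearEquiv k).trans (Finsupp.mapRange.linearEquiv b.repr.symm))

lemma T_single (i : Option I) (u : U) :
    T b e (Finsupp.single (e.symm (i, u)) 1) = Finsupp.single u (b i) := by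
  simp [T, Finsupp.curryLinearEquiv]

lemma T_symm_single (i : Option I) (u : U) :
    (T b e).symm (Finsupp.single u (b i)) = Finsupp.single (e.symm (i, u)) 1 := by
  rw [LinearEquiv.symm_apply_eq, T_single]

/-- The action of `A` on the space with basis `X`. -/
noncomputable def act : A →ₐ[k] Module.End k (X →₀ k) :=
  ((T b e).symm.conjAlgEquiv k).toAlgHom.comp (Algebra.lsmul k k (U →₀ A))

lemma act_apply (a : A) (m : X →₀ k) : act b e a m = (T b e).symm (a • T b e m) := rfl

lemma act_single (hb : b none = 1) (i : Option I) (u : U) :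
    act b e (b i) (Finsupp.single (e.symm (none, u)) 1) = Finsupp.single (e.symm (i, u)) 1 := by
  rw [act_apply, T_single, hb, Finsupp.smul_single, smul_eq_mul, mul_one, T_symm_single]

variable {P : Type} [Ring P] [Algebra k P] (ι : A →ₐ[k] P) (w : X → P)

lemma lift_symm (hw : ∀ i u, w (e.symm (i, u)) = ι (b i) * w (e.symm (none, u))) (u : U) (a : A) :
    Finsupp.linearCombination k w ((T b e).symm (Finsupp.single u a))
      = ι a * w (e.symm (none, u)) := by
  have : (Finsupp.linearCombination k w) ∘ₗ (T b e).symm.toLinearMap ∘ₗ Finsupp.lsingle u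
      = (LinearMap.mulRight k (w (e.symm (none, u)))) ∘ₗ ι.toLinearMap := by
    refine b.ext fun i => ?_
    simp [T_symm_single, hw i u]
  exact LinearMap.congr_fun this a

lemma lift_smul (hw : ∀ i u, w (e.symm (i, u)) = ι (b i) * w (e.symm (none, u)))
    (a : A) (f : U →₀ A) :
    Finsupp.linearCombination k w ((T b e).symm (a • f))
      = ι a * Finsupp.linearCombination k w ((T b e).symm f) := by
  induction f using Finsupp.induction_linear with
  | zero => simp
  | add f g hf hg => simp only [smul_add, map_add, mul_add, hf, hg]
  | single u c =>
    rw [Finsupp.smul_single, lift_symm b e ι w hw, lift_symm b e ι w hw, smul_eq_mul, map_mul,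
      mul_assoc]

lemma lift_act (hw : ∀ i u, w (e.symm (i, u)) = ι (b i) * w (e.symm (none, u)))
    (a : A) (m : X →₀ k) :
    Finsupp.linearCombination k w (act b e a m) = ι a * Finsupp.linearCombination k w m := by
  rw [act_apply, lift_smul b e ι w hw, LinearEquiv.symm_apply_apply]

end Action

/-- Normal words. -/
abbrev Wd (I J : Type) : Type := Option I × (List (J × I) × Option J)

/-- Splitting off the first letter from `B`. -/
def eB (I J : Type) : Wd I J ≃ Option J × Option (I × List (J × I) × Option J) where
  toFun
    | (some i, l, o) => (none, some (i, l, o))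
    | (none, (j, i) :: l, o) => (some j, some (i, l, o))
    | (none, [], o) => (o, none)
  invFun
    | (none, some (i, l, o)) => (some i, l, o)
    | (some j, some (i, l, o)) => (none, (j, i) :: l, o)
    | (o, none) => (none, [], o)
  left_inv := by
    rintro ⟨_ | i, _ | ⟨⟨j, i'⟩, l⟩, _ | o⟩ <;> rfl
  right_inv := by
    rintro ⟨_ | j, _ | ⟨i, l, o⟩⟩ <;> rfl

lemma eB_symm_none (I J : Type) (o : Option J) : (eB I J).symm (o, none) = (none, [], o) := by
  cases o <;> rfl

/-- A subalgebra of the coproduct containing both factors is everything. -/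
lemma mem_of_isFreeProduct {k : Type} [Field k]
    {A B P : Type} [Ring A] [Algebra k A] [Ring B] [Algebra k B] [Ring P] [Algebra k P]
    {ιA : A →ₐ[k] P} {ιB : B →ₐ[k] P}
    (hfp : IsFreeProduct k ιA ιB) (S : Subalgebra k P) (hA : ∀ a, ιA a ∈ S) (hB : ∀ a, ιB a ∈ S)
    (p : P) : p ∈ S := by
  obtain ⟨h, ⟨h1, h2⟩, -⟩ := hfp S (ιA.codRestrict S hA) (ιB.codRestrict S hB)
  have key : S.val.comp h = AlgHom.id k P := by
    refine (hfp P ιA ιB).unique ⟨?_, ?_⟩ ⟨?_, ?_⟩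
    · rw [AlgHom.comp_assoc, h1]; rfl
    · rw [AlgHom.comp_assoc, h2]; rfl
    · rfl
    · rfl
  have := DFunLike.congr_fun key p
  have h3 : ((h p : S) : P) = p := this
  rw [← h3]
  exact (h p).2

end FreeProd

open FreeProd

/-- Let `A` and `B` be augmented algebras over a field `k`. Then the free
product `A * B`, regarded as a left `A`-module via the canonical homomorphism `ιA : A → A * B`,
is a free `A`-module. -/
theorem statement7 (k : Type) [Field k]
    (A B P : Type) [Ring A] [Algebra k A] [Ring B] [Algebra k B] [Ring P] [Algebra k P]
    (ιA : A →ₐ[k] P) (ιB : B →ₐ[k] P)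
    (hfp : IsFreeProduct k ιA ιB)
    (εA : A →ₐ[k] k) (εB : B →ₐ[k] k) :
    letI : Module A P := Module.compHom P ιA.toRingHom
    Module.Free A P := by
  letI : Module A P := Module.compHom P ιA.toRingHom
  show Module.Free A P
  haveI : Nontrivial A := εA.toRingHom.domain_nontrivial
  haveI : Nontrivial B := εB.toRingHom.domain_nontrivial
  obtain ⟨I, bA, hbA⟩ := exists_basis k A
  obtain ⟨J, bB, hbB⟩ := exists_basis k B
  let w : Wd I J → P := fun x => ιA (bA x.1) *
    ((x.2.1.map fun q => ιB (bB (some q.1)) * ιA (bA (some q.2))).prod * ιB (bB x.2.2))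
  let eA : Wd I J ≃ Option I × (List (J × I) × Option J) := Equiv.refl _
  have hwA : ∀ i u, w (eA.symm (i, u)) = ιA (bA i) * w (eA.symm (none, u)) := by
    intro i u
    simp [w, eA, hbA]
  have hwB : ∀ j u, w ((eB I J).symm (j, u)) = ιB (bB j) * w ((eB I J).symm (none, u)) := by
    rintro (_ | j) (_ | ⟨i, l, o⟩) <;> simp [w, eB, hbA, hbB, mul_assoc]
  let φ := Finsupp.linearCombination k w
  obtain ⟨ρ, ⟨hρA, hρB⟩, -⟩ := hfp (Module.End k (Wd I J →₀ k)) (act bA eA) (act bB (eB I J))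
  have hρA' : ∀ a, ρ (ιA a) = act bA eA a := fun a => DFunLike.congr_fun hρA a
  have hρB' : ∀ a, ρ (ιB a) = act bB (eB I J) a := fun a => DFunLike.congr_fun hρB a
  -- equivariance
  have heq : ∀ p m, φ (ρ p m) = p * φ m := by
    let S : Subalgebra k P :=
      { carrier := {p | ∀ m, φ (ρ p m) = p * φ m}
        mul_mem' := by
          intro a c ha hc m
          rw [map_mul, Module.End.mul_apply, ha, hc, mul_assoc]
        add_mem' := by
          intro a c ha hc m
          rw [map_add, LinearMap.add_apply, map_add, ha, hc, add_mul]
        algebraMap_mem' := by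
          intro r m
          rw [AlgHom.commutes, Module.algebraMap_end_apply, map_smul, Algebra.smul_def] }
    intro p
    refine mem_of_isFreeProduct hfp S ?_ ?_ p
    · intro a m
      rw [hρA']
      exact lift_act bA eA ιA w hwA a m
    · intro a m
      rw [hρB']
      exact lift_act bB (eB I J) ιB w hwB a m
  let v : Wd I J →₀ k := Finsupp.single (none, [], none) 1
  have hφv : φ v = 1 := by simp [φ, v, w, hbA, hbB]
  have hword : ∀ x, ρ (w x) v = Finsupp.single x 1 := by
    have step : ∀ l o, ρ (w (none, l, o)) v = Finsupp.single (none, l, o) 1 →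
        ∀ i, ρ (w (i, l, o)) v = Finsupp.single (i, l, o) 1 := by
      intro l o h i
      have h1 : w (i, l, o) = ιA (bA i) * w (none, l, o) := hwA i (l, o)
      rw [h1, map_mul, Module.End.mul_apply, h, hρA']
      exact act_single bA eA hbA i (l, o)
    suffices h : ∀ l o, ρ (w (none, l, o)) v = Finsupp.single (none, l, o) 1 by
      rintro ⟨i, l, o⟩
      exact step l o (h l o) i
    intro l o
    induction l with
    | nil =>
      have h0 := hwB o none
      have h1 := act_single bB (eB I J) hbB o none
      rw [eB_symm_none, eB_symm_none] at h0 h1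
      have h2 : w (none, [], none) = 1 := by simp [w, hbA, hbB]
      rw [h0, h2, mul_one, hρB']
      exact h1
    | cons q l ih =>
      obtain ⟨j, i⟩ := q
      have h0 : w (none, (j, i) :: l, o) = ιB (bB (some j)) * w (some i, l, o) :=
        hwB (some j) (some (i, l, o))
      rw [h0, map_mul, Module.End.mul_apply, step l o ih, hρB']
      exact act_single bB (eB I J) hbB (some j) (some (i, l, o))
  have hinv : ∀ m, ρ (φ m) v = m := by
    intro m
    induction m using Finsupp.induction_linear with
    | zero => simp
    | add f g hf hg => rw [map_add, map_add, LinearMap.add_apply, hf, hg]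
    | single x c =>
      simp [φ, hword]
  have hinv' : ∀ p, φ (ρ p v) = p := fun p => by rw [heq, hφv, mul_one]
  let Φ : ((List (J × I) × Option J) →₀ A) →ₗ[A] P :=
    { toFun := fun f => φ ((T bA eA).symm f)
      map_add' := fun f g => by rw [map_add, map_add]
      map_smul' := fun a f => lift_smul bA eA ιA w hwA a f }
  have hΦ : Function.Bijective Φ := by
    constructor
    · intro f g h
      have h' : φ ((T bA eA).symm f) = φ ((T bA eA).symm g) := h
      have h2 := congrArg (fun p => ρ p v) h'
      simp only [hinv] at h2
      exact (T bA eA).symm.injective h2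
    · intro p
      refine ⟨T bA eA (ρ p v), ?_⟩
      show φ ((T bA eA).symm (T bA eA (ρ p v))) = p
      rw [LinearEquiv.symm_apply_apply, hinv']
  exact Module.Free.of_equiv (LinearEquiv.ofBijective Φ hΦ)
end
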